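/- arXiv:1005.1893 — 3 statements merged into one kernel-verified Lean document; each statement's English description precedes it below -/
import Mathlib

section
/- Let n ≥ 2 and let τ be a uniformly random permutation of {1,…,n}. Then the expected length of the longest alternating subsequence of τ satisfies E[LAₙ(τ)] = 2n/3 + 1/6. -/
open MeasureTheory ProbabilityTheory Filter Finset

noncomputable section

/-- A list of values is alternating (starting with a descent):
`l 0 > l 1 < l 2 > l 3 < ⋯`. -/
def IsAltList {α : Type*} [LT α] (l : List α) : Prop :=
  ∀ i : ℕ, ∀ h : i + 1 < l.length,
    if i % 2 = 0 then l[i+1]'h < l[i]'(Nat.lt_of_succ_lt h)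
    else l[i]'(Nat.lt_of_succ_lt h) < l[i+1]'h

/-- The length of the longest alternating subsequence of the finite sequence
`a : Fin n → α`: the largest `m` for which there is an increasing list of `m`
indices along which `a` alternates (starting with a descent). -/
def LAfin {α : Type*} [LinearOrder α] {n : ℕ} (a : Fin n → α) : ℕ :=
  sSup {m | ∃ l : List (Fin n), l.length = m ∧ l.Chain' (· < ·) ∧ IsAltList (l.map a)}

/-- The length of the alternating subsequence found greedily in `b 0, …, b i`. -/
def greedyLen (b : ℕ → ℕ) : ℕ → ℕ
  | 0 => 1
  | i + 1 =>
    if (greedyLen b i % 2 = 1 ∧ b (i + 1) < b i) ∨ (greedyLen b i % 2 = 0 ∧ b i < b (i + 1)) then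
      greedyLen b i + 1
    else greedyLen b i

lemma greedyLen_mono (b : ℕ → ℕ) : Monotone (greedyLen b) :=
  monotone_nat_of_le_succ fun i => by rw [greedyLen]; split_ifs <;> omega

lemma one_le_greedyLen (b : ℕ → ℕ) (i : ℕ) : 1 ≤ greedyLen b i :=
  greedyLen_mono b (Nat.zero_le i)

/-- Where `greedyLen` is constant, the sequence is weakly monotone. -/
lemma monotone_of_greedyLen_eq (b : ℕ → ℕ) {i j : ℕ} (hij : i ≤ j)
    (h : greedyLen b j = greedyLen b i) :
    (greedyLen b i % 2 = 1 → b i ≤ b j) ∧ (greedyLen b i % 2 = 0 → b j ≤ b i) := by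
  induction j, hij using Nat.le_induction with
  | base => simp
  | succ j hij ih =>
    have h1 := greedyLen_mono b hij
    have h2 := greedyLen_mono b (Nat.le_succ j)
    have h3 : greedyLen b j = greedyLen b i := by
      simp only [Nat.succ_eq_add_one] at h2; omega
    have ih := ih h3
    rw [greedyLen] at h
    split_ifs at h with hc
    · omega
    · rw [h3] at hc
      constructor <;> intro hp <;> have := ih.1 <;> have := ih.2 <;> omega

/-- An increasing sequence of positions along which `b` alternates advances `greedyLen`. -/
lemma lt_greedyLen_of_alternating (b s : ℕ → ℕ) (m : ℕ)
    (hs : ∀ k, k + 1 < m → s k < s (k + 1))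
    (ha : ∀ k, k + 1 < m → if k % 2 = 0 then b (s (k + 1)) < b (s k) else b (s k) < b (s (k + 1)))
    (k : ℕ) (hk : k < m) : k < greedyLen b (s k) := by
  induction k with
  | zero => exact one_le_greedyLen b _
  | succ k ih =>
    have ih := ih (by omega)
    have h1 := greedyLen_mono b (hs k hk).le
    by_contra hlt
    have h2 : greedyLen b (s k) = k + 1 := by omega
    have h3 := monotone_of_greedyLen_eq b (hs k hk).le (by omega)
    have h4 := ha k hk
    rw [h2] at h3
    split_ifs at h4 with hp
    · have := h3.1 (by omega); omega
    · have := h3.2 (by omega); omega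

/-- The greedy length is attained by an alternating sequence of positions. -/
lemma exists_alternating_greedyLen (b : ℕ → ℕ) (i : ℕ) (hne : ∀ k < i, b k ≠ b (k + 1)) :
    ∃ s : ℕ → ℕ, (∀ k, k + 1 < greedyLen b i → s k < s (k + 1)) ∧
      (∀ k, k + 1 < greedyLen b i →
        if k % 2 = 0 then b (s (k + 1)) < b (s k) else b (s k) < b (s (k + 1))) ∧
      s (greedyLen b i - 1) = i ∧ ∀ k < greedyLen b i, s k ≤ i := by
  induction i with
  | zero => exact ⟨fun _ => 0, by simp [greedyLen]⟩
  | succ i ih =>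
    obtain ⟨s, h1, h2, h3, h4⟩ := ih fun k hk => hne k (by omega)
    have hn := hne i (by omega)
    have hpos := one_le_greedyLen b i
    rw [greedyLen]
    split_ifs with hc
    · generalize greedyLen b i = m at *
      refine ⟨fun k => if k < m then s k else i + 1, ?_, ?_, ?_, ?_⟩
      · intro k hk
        have := h1 k
        have := h4 k
        grind
      · intro k hk
        have := h2 k
        by_cases hkm : k + 1 < m
        · have : k < m := by omega
          grind
        · have : k = m - 1 := by omega
          subst this
          have : m - 1 < m := by omega
          grind
      · simp
      · intro k hk
        have := h4 k
        grind
    · generalize greedyLen b i = m at *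
      refine ⟨fun k => if k < m - 1 then s k else i + 1, ?_, ?_, ?_, ?_⟩
      · intro k hk
        have := h1 k
        have := h4 k
        grind
      · intro k hk
        have halt := h2 k hk
        have : k < m - 1 := by omega
        by_cases hkm : k + 1 < m - 1
        · grind
        · have hk' : k + 1 = m - 1 := by omega
          simp only [hk', h3] at halt
          grind
      · simp
      · intro k hk
        have := h4 k
        grind

/-- The longest alternating subsequence of a finite sequence without equal neighbours has the
greedy length. -/
lemma LAfin_eq_greedyLen {n N : ℕ} (a : Fin (n + 1) → Fin N) (b : ℕ → ℕ)
    (hab : ∀ i : Fin (n + 1), b i = a i) (hne : ∀ k < n, b k ≠ b (k + 1)) :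
    LAfin a = greedyLen b n := by
  refine IsGreatest.csSup_eq ⟨?_, ?_⟩
  · obtain ⟨s, h1, h2, -, h4⟩ := exists_alternating_greedyLen b n hne
    refine ⟨List.ofFn fun k : Fin (greedyLen b n) => (⟨s k, by have := h4 k k.2; omega⟩ :
      Fin (n + 1)), by simp, ?_, ?_⟩
    · refine List.isChain_iff_getElem.2 ?_
      intro k hk
      simp only [List.length_ofFn] at hk
      simpa using h1 k hk
    · intro k hk
      simp only [List.length_map, List.length_ofFn] at hk
      have := h2 k hk
      simp only [List.getElem_map, List.getElem_ofFn, Fin.lt_def, ← hab]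
      exact this
  · rintro m ⟨l, rfl, hc, ha⟩
    replace hc := List.isChain_iff_getElem.1 hc
    rcases Nat.eq_zero_or_pos l.length with h0 | hpos
    · omega
    have key := lt_greedyLen_of_alternating b (fun k => if h : k < l.length then l[k] else 0)
      l.length ?_ ?_ (l.length - 1) (by omega)
    · refine le_trans (by omega) (key.trans_le (greedyLen_mono b ?_) : l.length - 1 < _)
      split_ifs <;> omega
    · intro k hk
      have := hc k hk
      have hk' : k < l.length := by omega
      simpa [hk, hk'] using this
    · intro k hk
      have := ha k (by simpa using hk)
      have hk' : k < l.length := by omega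
      simpa [hk, hk', hab] using this

/-- The greedy length counts an initial descent and the interior local extrema. -/
lemma greedyLen_succ (b : ℕ → ℕ) (i : ℕ) (hne : ∀ k < i + 1, b k ≠ b (k + 1)) :
    greedyLen b (i + 1) = 1 + (if b 1 < b 0 then 1 else 0) +
        ∑ j ∈ range i, (if (b j < b (j + 1) ↔ b (j + 1) < b (j + 2)) then 0 else 1) ∧
      (greedyLen b (i + 1) % 2 = 1 ↔ b i < b (i + 1)) := by
  induction i with
  | zero =>
    have := hne 0 (by omega)
    simp only [greedyLen, range_zero, sum_empty]
    grind
  | succ i ih =>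
    obtain ⟨h1, h2⟩ := ih fun k hk => hne k (by omega)
    have hn := hne i (by omega)
    have hn' := hne (i + 1) (by omega)
    rw [greedyLen, sum_range_succ, ← add_assoc, ← h1]
    grind

/-- Permuting positions does not change a sum over all permutations. -/
lemma sum_perm_mul_right {n : ℕ} (σ : Equiv.Perm (Fin n)) (g : Equiv.Perm (Fin n) → ℝ) :
    ∑ τ, g (τ * σ) = ∑ τ, g τ :=
  Equiv.sum_comp (Equiv.mulRight σ) g

lemma sum_perm_descent {n : ℕ} {i j : Fin n} (hij : i ≠ j) :
    ∑ τ : Equiv.Perm (Fin n), (if τ j < τ i then 1 else 0 : ℝ) =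
      (Fintype.card (Equiv.Perm (Fin n)) : ℝ) / 2 := by
  have h := sum_perm_mul_right (Equiv.swap i j) fun τ => (if τ j < τ i then 1 else 0 : ℝ)
  have h2 : ∑ τ : Equiv.Perm (Fin n), ((if τ i < τ j then 1 else 0 : ℝ) +
      (if τ j < τ i then 1 else 0 : ℝ)) = Fintype.card (Equiv.Perm (Fin n)) := by
    rw [Fintype.card_eq_sum_ones, Nat.cast_sum]
    refine sum_congr rfl fun τ _ => ?_
    have := τ.injective.ne hij
    split_ifs <;> first | (norm_num; done) | omega
  simp only [Equiv.Perm.mul_apply, Equiv.swap_apply_left, Equiv.swap_apply_right] at h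
  rw [sum_add_distrib] at h2
  linarith

lemma sum_perm_extremum {n : ℕ} {i j k : Fin n} (hij : i ≠ j) (hjk : j ≠ k) (hik : i ≠ k) :
    ∑ τ : Equiv.Perm (Fin n), (if (τ i < τ j ↔ τ j < τ k) then 0 else 1 : ℝ) =
      2 * (Fintype.card (Equiv.Perm (Fin n)) : ℝ) / 3 := by
  have h := sum_perm_mul_right (Equiv.swap i j) fun τ =>
    (if (τ i < τ j ↔ τ j < τ k) then 0 else 1 : ℝ)
  have h' := sum_perm_mul_right (Equiv.swap k j) fun τ =>
    (if (τ i < τ j ↔ τ j < τ k) then 0 else 1 : ℝ)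
  have h2 : ∑ τ : Equiv.Perm (Fin n), ((if (τ j < τ i ↔ τ i < τ k) then 0 else 1 : ℝ) +
      (if (τ i < τ k ↔ τ k < τ j) then 0 else 1 : ℝ) +
      (if (τ i < τ j ↔ τ j < τ k) then 0 else 1 : ℝ)) =
        2 * Fintype.card (Equiv.Perm (Fin n)) := by
    rw [Fintype.card_eq_sum_ones, Nat.cast_sum, mul_sum]
    refine sum_congr rfl fun τ _ => ?_
    have := τ.injective.ne hij
    have := τ.injective.ne hjk
    have := τ.injective.ne hik
    split_ifs <;> first | (norm_num; done) | omega
  simp only [Equiv.Perm.mul_apply, Equiv.swap_apply_left, Equiv.swap_apply_right,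
    Equiv.swap_apply_of_ne_of_ne hik.symm hjk.symm, Equiv.swap_apply_of_ne_of_ne hik hij] at h h'
  rw [sum_add_distrib, sum_add_distrib] at h2
  linarith

lemma LAfin_perm {m : ℕ} (τ : Equiv.Perm (Fin (m + 2))) :
    (LAfin (fun i => τ i) : ℝ) = 1 + (if τ 1 < τ 0 then 1 else 0) + ∑ j : Fin m,
      (if (τ j.castSucc.castSucc < τ j.castSucc.succ ↔ τ j.castSucc.succ < τ j.succ.succ)
        then 0 else 1) := by
  set b : ℕ → ℕ := fun k => if h : k < m + 2 then (τ ⟨k, h⟩ : ℕ) else 0 with hb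
  have hne : ∀ k < m + 1, b k ≠ b (k + 1) := by
    intro k hk
    have h1 : k < m + 2 := by omega
    have h2 : k + 1 < m + 2 := by omega
    simp only [hb, h1, h2, dif_pos]
    rw [Ne, Fin.val_inj, τ.injective.eq_iff]
    simp
  rw [LAfin_eq_greedyLen (fun i => τ i) b (by simp [hb]) hne, (greedyLen_succ b m hne).1,
    ← Fin.sum_univ_eq_sum_range (fun j => if (b j < b (j + 1) ↔ b (j + 1) < b (j + 2)) then 0
      else 1) m]
  push_cast
  refine congrArg₂ (· + ·) (by simp [hb]) (sum_congr rfl fun j _ => ?_)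
  have h0 : (j : ℕ) < m + 2 := by omega
  have h1 : (j : ℕ) + 1 < m + 2 := by omega
  have h2 : (j : ℕ) + 2 < m + 2 := by omega
  simp only [hb, h0, h1, h2, dif_pos, Fin.val_fin_lt]
  rfl

/-- for `n ≥ 2` and a uniformly random permutation `τ` of `{1,…,n}`,
`E[LAₙ(τ)] = 2n/3 + 1/6`. -/
theorem stmt0 (n : ℕ) (hn : 2 ≤ n) :
    (∑ τ : Equiv.Perm (Fin n), (LAfin (fun i => τ i) : ℝ))
        / (Fintype.card (Equiv.Perm (Fin n)) : ℝ)
      = 2 * n / 3 + 1 / 6 := by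
  obtain ⟨m, rfl⟩ := Nat.exists_eq_add_of_le' hn
  have hc : (Fintype.card (Equiv.Perm (Fin (m + 2))) : ℝ) ≠ 0 := by
    exact_mod_cast Fintype.card_ne_zero
  rw [div_eq_iff hc]
  simp only [LAfin_perm]
  rw [sum_add_distrib, sum_add_distrib, sum_comm, sum_perm_descent (by simp)]
  have h : ∀ j : Fin m, _ = _ := fun j => sum_perm_extremum (i := j.castSucc.castSucc)
    (j := j.castSucc.succ) (k := j.succ.succ) (by simp [Fin.ext_iff]) (by simp [Fin.ext_iff])
    (by simp only [ne_eq, Fin.ext_iff, Fin.val_castSucc, Fin.val_succ]; omega)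
  rw [sum_congr rfl fun j _ => h j]
  simp only [sum_const, card_univ, Fintype.card_fin, nsmul_eq_mul]
  push_cast
  ring

end
end

section
/- Let n ≥ 4 and let τ be a uniformly random permutation of {1,…,n}. Then the variance of the length of the longest alternating subsequence of τ satisfies Var[LAₙ(τ)] = 8n/45 − 13/180. -/
open MeasureTheory ProbabilityTheory Filter Finset

noncomputable section

/-- The values of `a` along the first `m` indices of `f` alternate, starting with a descent. -/
def IsAltAlong {α : Type*} [LT α] (a : ℕ → α) (m : ℕ) (f : ℕ → ℕ) : Prop :=
  ∀ i, i + 1 < m → f i < f (i + 1) ∧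
    if i % 2 = 0 then a (f (i + 1)) < a (f i) else a (f i) < a (f (i + 1))

/-- The number of turns made when greedily reading `a 0, …, a k`, looking first for a descent. -/
def turns {α : Type*} [LinearOrder α] (a : ℕ → α) : ℕ → ℕ
  | 0 => 0
  | k + 1 => turns a k +
      if (if turns a k % 2 = 0 then a (k + 1) < a k else a k < a (k + 1)) then 1 else 0

section Turns

variable {α : Type*} [LinearOrder α]

theorem IsAltAlong.le_turns (a : ℕ → α) (k : ℕ) : ∀ (m : ℕ) (f : ℕ → ℕ),
    IsAltAlong a (m + 1) f → f m ≤ k →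
      m ≤ turns a k ∧ (m = turns a k → if m % 2 = 0 then a (f m) ≤ a k else a k ≤ a (f m)) := by
  induction k with
  | zero =>
    intro m f hf hm
    rcases m with _ | m
    · have : f 0 = 0 := by omega
      simp [turns, this]
    · have := (hf m (by omega)).1
      omega
  | succ k ih =>
    intro m f hf hm
    rcases Nat.lt_or_ge (f m) (k + 1) with h | h
    · have h1 := ih m f hf (by omega)
      simp only [turns]
      split_ifs with h2 h3 h4 h5 <;> refine ⟨by omega, fun h6 => ?_⟩ <;> grind
    · have h0 : f m = k + 1 := by omega
      rcases m with _ | m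
      · simp [h0]
      · have h1 := hf m (by omega)
        have h2 := ih m f (fun i hi => hf i (by omega)) (by omega)
        have h3 : m + 1 ≤ turns a (k + 1) := by
          simp only [turns]
          split_ifs <;> grind
        exact ⟨h3, fun _ => by simp [h0]⟩

theorem exists_isAltAlong_turns (a : ℕ → α) (k : ℕ) :
    ∃ f, IsAltAlong a (turns a k + 1) f ∧ f (turns a k) = k := by
  induction k with
  | zero => exact ⟨fun _ => 0, fun i hi => by simp [turns] at hi, rfl⟩
  | succ k ih =>
    obtain ⟨f, hf, hk⟩ := ih
    refine ⟨Function.update f (turns a (k + 1)) (k + 1), fun i hi => ?_, by simp⟩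
    have h0 : turns a (k + 1) = turns a k ∨ turns a (k + 1) = turns a k + 1 := by
      simp only [turns]; split_ifs <;> simp
    rcases Nat.lt_or_ge (i + 1) (turns a (k + 1)) with h | h
    · rw [Function.update_of_ne (by omega), Function.update_of_ne (by omega)]
      exact hf i (by omega)
    · have h1 : i + 1 = turns a (k + 1) := by omega
      rw [← h1, Function.update_self, Function.update_of_ne (by omega)]
      rcases h0 with h0 | h0
      · have h2 := hf i (by omega)
        have h3 : (i + 1) % 2 = turns a k % 2 := by omega
        rw [h1, h0, hk] at h2
        simp only [turns] at h0
        split_ifs at h0 h2 ⊢ <;> grind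
      · have h2 : i = turns a k := by omega
        rw [h2, hk]
        simp only [turns] at h0
        grind

theorem LAfin_eq_turns {n : ℕ} (a : Fin (n + 1) → α) :
    LAfin a = turns (fun k => a (Fin.ofNat (n + 1) k)) n + 1 := by
  set b : ℕ → α := fun k => a (Fin.ofNat (n + 1) k) with hb
  have hba (i : Fin (n + 1)) : b i = a i := by simp [hb]
  refine IsGreatest.csSup_eq ⟨?_, ?_⟩
  · obtain ⟨f, hf, hn⟩ := exists_isAltAlong_turns b n
    have hle : ∀ j i, i + j = turns b n → f i ≤ n := by
      intro j
      induction j with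
      | zero =>
        intro i hi
        obtain rfl : i = turns b n := by omega
        exact hn.le
      | succ j ih =>
        intro i hi
        have := ih (i + 1) (by omega)
        have := (hf i (by omega)).1
        omega
    refine ⟨List.ofFn (fun i : Fin (turns b n + 1) => Fin.ofNat (n + 1) (f i)), by simp, ?_, ?_⟩
    · rw [List.Chain', List.isChain_iff_getElem]
      intro i hi
      simp only [List.length_ofFn] at hi
      have := (hf i hi).1
      have := hle (turns b n - i) i (by omega)
      have := hle (turns b n - (i + 1)) (i + 1) (by omega)
      simp only [List.getElem_ofFn, Fin.lt_def, Fin.ofNat]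
      rw [Nat.mod_eq_of_lt (by omega), Nat.mod_eq_of_lt (by omega)]
      assumption
    · intro i hi
      simp only [List.length_map, List.length_ofFn] at hi
      simpa only [List.getElem_map, List.getElem_ofFn] using (hf i hi).2
  · rintro m ⟨l, rfl, hl, ha⟩
    rcases hm : l.length with _ | m
    · omega
    rw [List.Chain', List.isChain_iff_getElem] at hl
    have key : IsAltAlong b (m + 1) (fun i => (l.getD i 0 : Fin (n + 1))) := by
      intro i hi
      have h1 := hl i (by omega)
      have h2 := ha i (by simpa [hm] using hi)
      simp only [hba]
      rw [List.getD_eq_getElem _ _ (by omega), List.getD_eq_getElem _ _ (by omega)]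
      refine ⟨h1, by simpa using h2⟩
    have := (IsAltAlong.le_turns b n m _ key (by omega)).1
    omega

theorem turns_succ_of_ne (a : ℕ → α) (N : ℕ) (ha : ∀ k < N + 1, a k ≠ a (k + 1)) :
    (turns a (N + 1) % 2 = 0 ↔ a N < a (N + 1)) ∧
    turns a (N + 1) = (if a 0 < a 1 then 0 else 1) +
      ∑ k ∈ range N, if (a k < a (k + 1) ↔ a (k + 1) < a (k + 2)) then 0 else 1 := by
  induction N with
  | zero =>
    have := ha 0 (by omega)
    simp only [turns, range_zero, sum_empty]
    grind
  | succ N ih =>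
    have h := ih fun k hk => ha k (by omega)
    have h1 := ha N (by omega)
    have h2 := ha (N + 1) (by omega)
    rw [sum_range_succ, ← add_assoc, ← h.2]
    have h3 := h.1
    rw [turns]
    grind

end Turns

section PatternSums

open Equiv

theorem exists_perm_lt_iff_lt {β : Type*} [LinearOrder β] {m : ℕ} {v : Fin m → β}
    (hv : Function.Injective v) : ∃ ρ : Perm (Fin m), ∀ i j, v i < v j ↔ ρ i < ρ j := by
  have h : StrictMono (v ∘ Tuple.sort v) :=
    (Tuple.monotone_sort v).strictMono_of_injective (hv.comp (Tuple.sort v).injective)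
  refine ⟨(Tuple.sort v)⁻¹, fun i j => ?_⟩
  rw [← h.lt_iff_lt]
  simp

/-- The relative order of any `m` values of a uniformly random permutation is uniform. -/
theorem sum_perm_pattern {m n : ℕ} (ι : Fin m ↪ Fin n) (G : (Fin m → Fin m → Bool) → ℤ) :
    (m.factorial : ℤ) * ∑ τ : Perm (Fin n), G (fun i j => decide (τ (ι i) < τ (ι j))) =
      n.factorial * ∑ π : Perm (Fin m), G (fun i j => decide (π i < π j)) := by
  have h1 (π : Perm (Fin m)) :
      ∑ τ : Perm (Fin n), G (fun i j => decide (τ (ι i) < τ (ι j))) =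
        ∑ τ : Perm (Fin n), G (fun i j => decide (τ (ι (π i)) < τ (ι (π j)))) := by
    rw [← Equiv.sum_comp (Equiv.mulRight (π.viaFintypeEmbedding ι))]
    simp
  have h2 (τ : Perm (Fin n)) :
      ∑ π : Perm (Fin m), G (fun i j => decide (τ (ι (π i)) < τ (ι (π j)))) =
        ∑ π : Perm (Fin m), G (fun i j => decide (π i < π j)) := by
    obtain ⟨ρ, hρ⟩ := exists_perm_lt_iff_lt (τ.injective.comp ι.injective)
    have hρ' (i j : Fin m) : decide (τ (ι i) < τ (ι j)) = decide (ρ i < ρ j) :=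
      decide_eq_decide.2 (hρ i j)
    rw [← Equiv.sum_comp (Equiv.mulLeft ρ) fun π => G fun i j => decide (π i < π j)]
    simp only [hρ']
    rfl
  calc _ = ∑ π : Perm (Fin m), ∑ τ : Perm (Fin n),
        G (fun i j => decide (τ (ι i) < τ (ι j))) := by
        simp [Fintype.card_perm]
    _ = ∑ τ : Perm (Fin n), ∑ π : Perm (Fin m),
        G (fun i j => decide (τ (ι (π i)) < τ (ι (π j)))) := by
        rw [sum_congr rfl fun π _ => h1 π, sum_comm]
    _ = _ := by simp [h2, Fintype.card_perm]

/-- Whether `τ` ascends from position `k` to position `k + 1`. -/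
def ascends {n : ℕ} (τ : Perm (Fin (n + 1))) (k : ℕ) : Bool :=
  decide (τ (Fin.ofNat (n + 1) k) < τ (Fin.ofNat (n + 1) (k + 1)))

/-- Twice the centered indicator of a descent. -/
def descentSign (b : Bool) : ℤ := if b then -1 else 1

/-- Three times the centered indicator of a change of direction. -/
def turnSign (b c : Bool) : ℤ := if b = c then -2 else 1

theorem sum_perm_pattern_nat {m n : ℕ} (p : Fin m → ℕ) (hp : StrictMono p)
    (hpn : ∀ i, p i < n + 1) (G : (Fin m → Fin m → Bool) → ℤ) {c : ℤ}
    (hc : ∑ π : Perm (Fin m), G (fun i j => decide (π i < π j)) = c)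
    {F : Perm (Fin (n + 1)) → ℤ} (hF : ∀ τ, F τ = G fun i j =>
      decide (τ (Fin.ofNat (n + 1) (p i)) < τ (Fin.ofNat (n + 1) (p j)))) :
    (m.factorial : ℤ) * ∑ τ, F τ = (n + 1).factorial * c := by
  rw [← hc, sum_congr rfl fun τ _ => hF τ]
  refine sum_perm_pattern ⟨fun i => Fin.ofNat (n + 1) (p i), fun i j h => ?_⟩ G
  have h := congrArg Fin.val h
  simp only [Fin.ofNat, Nat.mod_eq_of_lt (hpn _)] at h
  exact hp.injective h

variable {n : ℕ}

theorem sum_descentSign (hn : 1 ≤ n) :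
    ∑ τ : Perm (Fin (n + 1)), descentSign (ascends τ 0) = 0 := by
  have h := sum_perm_pattern_nat (n := n) ![0, 1]
    (by simp [Fin.strictMono_iff_lt_succ, Fin.forall_fin_succ])
    (by simp [Fin.forall_fin_succ]; omega)
    (fun r => descentSign (r 0 1))
    (c := 0) (by decide +kernel)
    (F := fun τ => descentSign (ascends τ 0))
    (fun _ => rfl)
  rw [show Nat.factorial 2 = 2 from rfl] at h
  push_cast at h
  linarith

theorem sum_turnSign {i : ℕ} (hi : i + 2 ≤ n) :
    ∑ τ : Perm (Fin (n + 1)), turnSign (ascends τ i) (ascends τ (i + 1)) = 0 := by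
  have h := sum_perm_pattern_nat (n := n) ![i, i + 1, i + 2]
    (by simp [Fin.strictMono_iff_lt_succ, Fin.forall_fin_succ])
    (by simp [Fin.forall_fin_succ]; omega)
    (fun r => turnSign (r 0 1) (r 1 2))
    (c := 0) (by decide +kernel)
    (F := fun τ => turnSign (ascends τ i) (ascends τ (i + 1)))
    (fun _ => rfl)
  rw [show Nat.factorial 3 = 6 from rfl] at h
  push_cast at h
  linarith

theorem sum_turnSign_mul_self {i : ℕ} (hi : i + 2 ≤ n) :
    ∑ τ : Perm (Fin (n + 1)), turnSign (ascends τ i) (ascends τ (i + 1)) *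
      turnSign (ascends τ i) (ascends τ (i + 1)) = 2 * (n + 1).factorial := by
  have h := sum_perm_pattern_nat (n := n) ![i, i + 1, i + 2]
    (by simp [Fin.strictMono_iff_lt_succ, Fin.forall_fin_succ])
    (by simp [Fin.forall_fin_succ]; omega)
    (fun r => turnSign (r 0 1) (r 1 2) * turnSign (r 0 1) (r 1 2))
    (c := 12) (by decide +kernel)
    (F := fun τ => turnSign (ascends τ i) (ascends τ (i + 1)) *
      turnSign (ascends τ i) (ascends τ (i + 1)))
    (fun _ => rfl)
  rw [show Nat.factorial 3 = 6 from rfl] at h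
  push_cast at h
  linarith

theorem sum_turnSign_mul_succ {i : ℕ} (hi : i + 3 ≤ n) :
    4 * ∑ τ : Perm (Fin (n + 1)), turnSign (ascends τ i) (ascends τ (i + 1)) *
      turnSign (ascends τ (i + 1)) (ascends τ (i + 2)) = -(n + 1).factorial := by
  have h := sum_perm_pattern_nat (n := n) ![i, i + 1, i + 2, i + 3]
    (by simp [Fin.strictMono_iff_lt_succ, Fin.forall_fin_succ])
    (by simp [Fin.forall_fin_succ]; omega)
    (fun r => turnSign (r 0 1) (r 1 2) * turnSign (r 1 2) (r 2 3))
    (c := -6) (by decide +kernel)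
    (F := fun τ => turnSign (ascends τ i) (ascends τ (i + 1)) *
      turnSign (ascends τ (i + 1)) (ascends τ (i + 2)))
    (fun _ => rfl)
  rw [show Nat.factorial 4 = 24 from rfl] at h
  push_cast at h
  linarith

theorem sum_turnSign_mul_add_two {i : ℕ} (hi : i + 4 ≤ n) :
    20 * ∑ τ : Perm (Fin (n + 1)), turnSign (ascends τ i) (ascends τ (i + 1)) *
      turnSign (ascends τ (i + 2)) (ascends τ (i + 3)) = (n + 1).factorial := by
  have h := sum_perm_pattern_nat (n := n) ![i, i + 1, i + 2, i + 3, i + 4]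
    (by simp [Fin.strictMono_iff_lt_succ, Fin.forall_fin_succ])
    (by simp [Fin.forall_fin_succ]; omega)
    (fun r => turnSign (r 0 1) (r 1 2) * turnSign (r 2 3) (r 3 4))
    (c := 6) (by decide +kernel)
    (F := fun τ => turnSign (ascends τ i) (ascends τ (i + 1)) *
      turnSign (ascends τ (i + 2)) (ascends τ (i + 3)))
    (fun _ => rfl)
  rw [show Nat.factorial 5 = 120 from rfl] at h
  push_cast at h
  linarith

theorem sum_turnSign_mul_of_disjoint {i j : ℕ} (hij : i + 3 ≤ j) (hj : j + 2 ≤ n) :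
    ∑ τ : Perm (Fin (n + 1)), turnSign (ascends τ i) (ascends τ (i + 1)) *
      turnSign (ascends τ j) (ascends τ (j + 1)) = 0 := by
  have h := sum_perm_pattern_nat (n := n) ![i, i + 1, i + 2, j, j + 1, j + 2]
    (by simp [Fin.strictMono_iff_lt_succ, Fin.forall_fin_succ]; omega)
    (by simp [Fin.forall_fin_succ]; omega)
    (fun r => turnSign (r 0 1) (r 1 2) * turnSign (r 3 4) (r 4 5))
    (c := 0) (by decide +kernel)
    (F := fun τ => turnSign (ascends τ i) (ascends τ (i + 1)) *
      turnSign (ascends τ j) (ascends τ (j + 1)))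
    (fun _ => rfl)
  rw [show Nat.factorial 6 = 720 from rfl] at h
  push_cast at h
  linarith

theorem sum_descentSign_mul_turnSign {i : ℕ} (hi : i + 2 ≤ n) :
    ∑ τ : Perm (Fin (n + 1)), descentSign (ascends τ 0) *
      turnSign (ascends τ i) (ascends τ (i + 1)) = 0 := by
  rcases i with _ | _ | i
  · have h := sum_perm_pattern_nat (n := n) ![0, 1, 2]
      (by simp [Fin.strictMono_iff_lt_succ, Fin.forall_fin_succ])
      (by simp [Fin.forall_fin_succ]; omega)
      (fun r => descentSign (r 0 1) * turnSign (r 0 1) (r 1 2))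
      (c := 0) (by decide +kernel)
      (F := fun τ => descentSign (ascends τ 0) *
        turnSign (ascends τ 0) (ascends τ 1))
      (fun _ => rfl)
    rw [show Nat.factorial 3 = 6 from rfl] at h
    push_cast at h
    linarith
  · have h := sum_perm_pattern_nat (n := n) ![0, 1, 2, 3]
      (by simp [Fin.strictMono_iff_lt_succ, Fin.forall_fin_succ])
      (by simp [Fin.forall_fin_succ]; omega)
      (fun r => descentSign (r 0 1) * turnSign (r 1 2) (r 2 3))
      (c := 0) (by decide +kernel)
      (F := fun τ => descentSign (ascends τ 0) *
        turnSign (ascends τ 1) (ascends τ 2))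
      (fun _ => rfl)
    rw [show Nat.factorial 4 = 24 from rfl] at h
    push_cast at h
    linarith
  · have h := sum_perm_pattern_nat (n := n) ![0, 1, i + 2, i + 3, i + 4]
      (by simp [Fin.strictMono_iff_lt_succ, Fin.forall_fin_succ])
      (by simp [Fin.forall_fin_succ]; omega)
      (fun r => descentSign (r 0 1) * turnSign (r 2 3) (r 3 4))
      (c := 0) (by decide +kernel)
      (F := fun τ => descentSign (ascends τ 0) *
        turnSign (ascends τ (i + 2)) (ascends τ (i + 3)))
      (fun _ => rfl)
    rw [show Nat.factorial 5 = 120 from rfl] at h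
    push_cast at h
    linarith

end PatternSums

/-- Six times the centered length of the longest alternating subsequence of `τ`. -/
def centeredLA {n : ℕ} (τ : Equiv.Perm (Fin (n + 1))) (N : ℕ) : ℤ :=
  3 * descentSign (ascends τ 0) + 2 * ∑ i ∈ range N, turnSign (ascends τ i) (ascends τ (i + 1))

section Moments

open Equiv

variable {n : ℕ}

theorem six_mul_LAfin (τ : Perm (Fin (n + 2))) :
    6 * (LAfin (fun i => τ i) : ℤ) = 4 * n + 9 + centeredLA τ n := by
  have hne : ∀ k < n + 1, τ (Fin.ofNat (n + 2) k) ≠ τ (Fin.ofNat (n + 2) (k + 1)) := by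
    intro k hk h
    have h := congrArg Fin.val (τ.injective h)
    simp only [Fin.ofNat] at h
    rw [Nat.mod_eq_of_lt (by omega), Nat.mod_eq_of_lt (by omega)] at h
    omega
  rw [LAfin_eq_turns, (turns_succ_of_ne _ n hne).2, centeredLA]
  have h1 : descentSign (ascends τ 0) =
      2 * (if τ (Fin.ofNat (n + 2) 0) < τ (Fin.ofNat (n + 2) 1) then 0 else 1) - 1 := by
    simp only [descentSign, ascends, decide_eq_true_eq]
    split_ifs <;> rfl
  have h2 (k : ℕ) : turnSign (ascends τ k) (ascends τ (k + 1)) =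
      3 * (if (τ (Fin.ofNat (n + 2) k) < τ (Fin.ofNat (n + 2) (k + 1)) ↔
        τ (Fin.ofNat (n + 2) (k + 1)) < τ (Fin.ofNat (n + 2) (k + 2))) then 0 else 1) - 2 := by
    simp only [turnSign, ascends, decide_eq_decide]
    split_ifs <;> rfl
  simp only [h1, h2, sum_sub_distrib, ← mul_sum]
  simp only [sum_const, card_range, nsmul_eq_mul]
  push_cast
  ring

theorem sum_centeredLA (hn : 1 ≤ n) {N : ℕ} (hN : N + 1 ≤ n) :
    ∑ τ : Perm (Fin (n + 1)), centeredLA τ N = 0 := by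
  simp only [centeredLA, sum_add_distrib, ← mul_sum]
  rw [sum_descentSign hn, sum_comm, sum_eq_zero fun i hi => sum_turnSign (by grind)]
  simp

theorem sum_centeredLA_mul_turnSign {N : ℕ} (hN : N + 4 ≤ n) :
    5 * ∑ τ : Perm (Fin (n + 1)), centeredLA τ (N + 2) *
      turnSign (ascends τ (N + 2)) (ascends τ (N + 3)) = -2 * (n + 1).factorial := by
  have h0 := sum_descentSign_mul_turnSign (i := N + 2) (n := n) (by omega)
  have h1 := sum_turnSign_mul_add_two hN
  have h2 := sum_turnSign_mul_succ (i := N + 1) (n := n) (by omega)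
  have h3 : ∑ τ : Perm (Fin (n + 1)), ∑ i ∈ range N,
      turnSign (ascends τ i) (ascends τ (i + 1)) *
        turnSign (ascends τ (N + 2)) (ascends τ (N + 3)) = 0 := by
    rw [sum_comm]
    exact sum_eq_zero fun i hi => sum_turnSign_mul_of_disjoint (by grind) (by omega)
  simp only [centeredLA, sum_range_succ, add_mul, mul_add, sum_add_distrib, mul_assoc, sum_mul,
    ← mul_sum]
  simp only [h0, h3]
  linarith

theorem sum_centeredLA_sq {N : ℕ} (hN : N + 3 ≤ n) :
    5 * ∑ τ : Perm (Fin (n + 1)), centeredLA τ (N + 2) ^ 2 =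
      (32 * N + 115) * (n + 1).factorial := by
  have hstep (M : ℕ) (hM : M + 2 ≤ n) :
      ∑ τ : Perm (Fin (n + 1)), centeredLA τ (M + 1) ^ 2 =
        ∑ τ : Perm (Fin (n + 1)), centeredLA τ M ^ 2 +
        4 * ∑ τ : Perm (Fin (n + 1)), centeredLA τ M *
          turnSign (ascends τ M) (ascends τ (M + 1)) + 8 * (n + 1).factorial := by
    have h := sum_turnSign_mul_self hM
    calc _ = ∑ τ : Perm (Fin (n + 1)), (centeredLA τ M ^ 2 +
          4 * (centeredLA τ M * turnSign (ascends τ M) (ascends τ (M + 1))) +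
          4 * (turnSign (ascends τ M) (ascends τ (M + 1)) *
            turnSign (ascends τ M) (ascends τ (M + 1)))) := by
          refine sum_congr rfl fun τ _ => ?_
          simp only [centeredLA, sum_range_succ]
          ring
      _ = _ := by
          rw [sum_add_distrib, sum_add_distrib, ← mul_sum, ← mul_sum, h]
          ring
  induction N with
  | zero =>
    have hsq : ∑ τ : Perm (Fin (n + 1)), centeredLA τ 0 ^ 2 = 9 * (n + 1).factorial := by
      have h (τ : Perm (Fin (n + 1))) : centeredLA τ 0 ^ 2 = 9 := by
        simp only [centeredLA, descentSign]
        split_ifs <;> simp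
      simp [h, Fintype.card_perm, mul_comm]
    have h0 := hstep 0 (by omega)
    have h1 := hstep 1 (by omega)
    have h2 := sum_descentSign_mul_turnSign (i := 0) (n := n) (by omega)
    have h3 := sum_descentSign_mul_turnSign (i := 1) (n := n) (by omega)
    have h4 := sum_turnSign_mul_succ (i := 0) (n := n) (by omega)
    have h5 : ∑ τ : Perm (Fin (n + 1)), centeredLA τ 0 *
        turnSign (ascends τ 0) (ascends τ (0 + 1)) = 0 := by
      simp [centeredLA, mul_assoc, ← mul_sum] at h2 ⊢
      exact h2
    have h6 : 2 * ∑ τ : Perm (Fin (n + 1)), centeredLA τ 1 *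
        turnSign (ascends τ 1) (ascends τ (1 + 1)) = -(n + 1).factorial := by
      simp only [centeredLA, sum_range_one, add_mul, sum_add_distrib, mul_assoc, ← mul_sum, h3]
      linarith
    push_cast
    linarith
  | succ N ih =>
    have h0 := hstep (N + 2) (by omega)
    have h1 := sum_centeredLA_mul_turnSign (N := N) (n := n) (by omega)
    have h2 := ih (by omega)
    push_cast
    linarith

end Moments

/-- for `n ≥ 4` and a uniformly random permutation `τ` of `{1,…,n}`,
`Var[LAₙ(τ)] = 8n/45 − 13/180`. -/
theorem stmt1 (n : ℕ) (hn : 4 ≤ n) :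
    (∑ τ : Equiv.Perm (Fin n),
        ((LAfin (fun i => τ i) : ℝ) -
          (∑ σ : Equiv.Perm (Fin n), (LAfin (fun i => σ i) : ℝ))
            / (Fintype.card (Equiv.Perm (Fin n)) : ℝ)) ^ 2)
        / (Fintype.card (Equiv.Perm (Fin n)) : ℝ)
      = 8 * n / 45 - 13 / 180 := by
  obtain ⟨m, rfl⟩ : ∃ m, n = m + 4 := ⟨n - 4, by omega⟩
  have hLA (τ : Equiv.Perm (Fin (m + 4))) : (LAfin (fun i => τ i) : ℝ) =
      (4 * m + 17) / 6 + (centeredLA τ (m + 2) : ℝ) / 6 := by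
    have h := six_mul_LAfin (n := m + 2) τ
    have h' : (6 : ℝ) * LAfin (fun i => τ i) = 4 * (m + 2) + 9 + centeredLA τ (m + 2) := by
      exact_mod_cast h
    linarith
  have h1 : ∑ τ : Equiv.Perm (Fin (m + 4)), (centeredLA τ (m + 2) : ℝ) = 0 := by
    exact_mod_cast sum_centeredLA (n := m + 3) (by omega) (by omega)
  have h2 : 5 * ∑ τ : Equiv.Perm (Fin (m + 4)), (centeredLA τ (m + 2) : ℝ) ^ 2 =
      (32 * m + 115) * (m + 4).factorial := by
    exact_mod_cast sum_centeredLA_sq (n := m + 3) (N := m) (by omega)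
  have h3 : ((m + 4).factorial : ℝ) ≠ 0 := by positivity
  have h4 : (∑ σ : Equiv.Perm (Fin (m + 4)), (LAfin (fun i => σ i) : ℝ)) /
      (m + 4).factorial = (4 * m + 17) / 6 := by
    simp only [hLA, sum_add_distrib, ← sum_div, h1]
    simp [Fintype.card_perm]
    field_simp
  simp only [Fintype.card_perm, Fintype.card_fin, h4]
  simp only [hLA, add_sub_cancel_left, div_pow, ← sum_div]
  rw [div_div, div_eq_iff (by positivity)]
  push_cast
  linarith

end
end

section
/- Let (x_k)_{k≥0} be an ergodic Markov chain on the finite linearly ordered state space [q] = {1,…,q}, with transition probabilities p_{r,s} (with p_{r,r} < 1 for all r) and stationary distribution π, started at stationarity. Let LAₙ(x₀,…,xₙ) be the length of the longest alternating subsequence of (x₀,…,xₙ). Then LAₙ(x₀,…,xₙ)/n converges, as n → ∞, both almost surely and in L¹, to Osc(x) = Σ_{t<s>r} π_t p_{t,s} p_{s,r}/(1 − p_{s,s}) + Σ_{t>s<r} π_t p_{t,s} p_{s,r}/(1 − p_{s,s}), where the first sum is over triples (t,s,r) with t < s and s > r, and the second over triples with t > s and s < r. -/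
open MeasureTheory ProbabilityTheory Filter Finset

noncomputable section

/-- The length of the longest alternating subsequence of `a` along the index
set `s`. -/
def LAon {α : Type*} [LinearOrder α] (a : ℕ → α) (s : Finset ℕ) : ℕ :=
  sSup {m | ∃ l : List ℕ, l.length = m ∧ l.Chain' (· < ·) ∧ (∀ i ∈ l, i ∈ s) ∧
    IsAltList (l.map a)}

/-- The oscillation of the Markov chain:
`Osc(x) = Σ_{t<s>r} π_t p_{t,s} p_{s,r}/(1 − p_{s,s})
        + Σ_{t>s<r} π_t p_{t,s} p_{s,r}/(1 − p_{s,s})`. -/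
def OscMC {q : ℕ} (p : Fin q → Fin q → ℝ) (π : Fin q → ℝ) : ℝ :=
  (∑ t, ∑ s, ∑ r, if t < s ∧ r < s then π t * p t s * p s r / (1 - p s s) else 0)
    + ∑ t, ∑ s, ∑ r, if s < t ∧ s < r then π t * p t s * p s r / (1 - p s s) else 0

/-! ### Longest alternating subsequences count turns -/

/-- Whether the step from `s` to `r` extends a greedy alternating subsequence of length `m`
ending at `s`: the next step must go down when `m` is odd and up when `m` is even. -/
def turn {α : Type*} [LinearOrder α] (m : ℕ) (s r : α) : ℕ :=
  if m % 2 = 1 then (if r < s then 1 else 0) else (if s < r then 1 else 0)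

/-- The length of the greedy alternating subsequence of `a 0, …, a n`. -/
def altCount {α : Type*} [LinearOrder α] (a : ℕ → α) : ℕ → ℕ
  | 0 => 1
  | n + 1 => altCount a n + turn (altCount a n) (a n) (a (n + 1))

lemma isAltList_singleton {α : Type*} [LT α] (a : α) : IsAltList [a] := by
  intro i h
  simp at h

lemma isAltList_concat_concat {α : Type*} [LT α] (l : List α) (a b : α) :
    IsAltList (l ++ [a] ++ [b]) ↔
      IsAltList (l ++ [a]) ∧ if l.length % 2 = 0 then b < a else a < b := by
  constructor
  · intro H
    refine ⟨fun i h => ?_, ?_⟩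
    · have := H i (by simp at h ⊢; omega)
      rwa [List.getElem_append_left h, List.getElem_append_left (Nat.lt_of_succ_lt h)] at this
    · have := H l.length (by simp)
      simpa using this
  · rintro ⟨H, H'⟩ i h
    by_cases hi : i + 1 < (l ++ [a]).length
    · have := H i hi
      rwa [List.getElem_append_left hi, List.getElem_append_left (Nat.lt_of_succ_lt hi)]
    · obtain rfl : i = l.length := by simp at h hi; omega
      simpa using H'

lemma isChain_concat_lt_of_forall_lt {l : List ℕ} {n : ℕ} (hl : l.IsChain (· < ·))
    (hn : ∀ i ∈ l, i < n) : (l ++ [n]).IsChain (· < ·) := by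
  rw [List.isChain_append]
  refine ⟨hl, List.isChain_singleton _, fun x hx y hy => ?_⟩
  simp only [List.head?_cons, Option.mem_def, Option.some.injEq] at hy
  exact hy ▸ hn x (List.mem_of_getLast? hx)

lemma isChain_of_concat_lt {l : List ℕ} {n : ℕ} (hl : (l ++ [n]).IsChain (· < ·)) :
    l.IsChain (· < ·) ∧ ∀ i ∈ l, i < n := by
  refine ⟨(List.isChain_append.1 hl).1, fun i hi => ?_⟩
  have := List.isChain_iff_pairwise.1 hl
  rw [List.pairwise_append] at this
  exact this.2.2 i hi n (by simp)

lemma exists_isAltList_altCount {α : Type*} [LinearOrder α] (a : ℕ → α) (n : ℕ) :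
    ∃ l : List ℕ, l.length + 1 = altCount a n ∧ l.IsChain (· < ·) ∧ (∀ i ∈ l, i < n) ∧
      IsAltList ((l ++ [n]).map a) := by
  induction n with
  | zero => exact ⟨[], rfl, List.isChain_nil, by simp, by simpa using isAltList_singleton _⟩
  | succ n ih =>
    obtain ⟨l, hlen, hc, hlt, halt⟩ := ih
    by_cases ht : turn (altCount a n) (a n) (a (n + 1)) = 0
    · refine ⟨l, by simp [altCount, ht, hlen], hc, fun i hi => (hlt i hi).trans n.lt_succ_self, ?_⟩
      rcases List.eq_nil_or_concat l with rfl | ⟨l', b, rfl⟩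
      · simpa using isAltList_singleton _
      · simp only [List.map_append, List.map_cons, List.map_nil, List.concat_eq_append,
          isAltList_concat_concat] at halt ⊢
        refine ⟨halt.1, ?_⟩
        have h2 := halt.2
        simp only [List.length_map, List.concat_eq_append, List.length_append, List.length_cons,
          List.length_nil] at h2 hlen ⊢
        unfold turn at ht
        split_ifs at ht h2 ⊢ <;> first | omega | order
    · refine ⟨l ++ [n], ?_, isChain_concat_lt_of_forall_lt hc hlt, ?_, ?_⟩
      · simp only [List.length_append, List.length_cons, List.length_nil, hlen, altCount]
        unfold turn at ht ⊢
        split_ifs at ht ⊢ <;> simp_all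
      · intro i hi
        rcases List.mem_append.1 hi with hi | hi
        · exact (hlt i hi).trans n.lt_succ_self
        · simp only [List.mem_singleton] at hi
          omega
      · simp only [List.map_append, List.map_cons, List.map_nil,
          isAltList_concat_concat] at halt ⊢
        refine ⟨halt, ?_⟩
        unfold turn at ht
        simp only [List.length_map]
        split_ifs at ht ⊢ <;> omega

lemma length_le_altCount {α : Type*} [LinearOrder α] (a : ℕ → α) (n : ℕ) :
    ∀ (l : List ℕ) (i : ℕ), (l ++ [i]).IsChain (· < ·) → i ≤ n → IsAltList ((l ++ [i]).map a) →
      l.length + 1 ≤ altCount a n ∧ (l.length + 1 = altCount a n →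
        if altCount a n % 2 = 1 then a i ≤ a n else a n ≤ a i) := by
  induction n with
  | zero =>
    intro l i hc hi halt
    obtain rfl : i = 0 := by omega
    have hl : l = [] := by
      refine List.eq_nil_iff_forall_not_mem.2 fun j hj => ?_
      have := (isChain_of_concat_lt hc).2 j hj
      omega
    subst hl
    simp [altCount]
  | succ n ih =>
    intro l i hc hi halt
    rcases Nat.lt_or_ge n i with hni | hni
    · obtain rfl : i = n + 1 := by omega
      rcases List.eq_nil_or_concat l with rfl | ⟨l', b, rfl⟩
      · simp only [List.length_nil, altCount, le_refl, ite_self, implies_true, and_true]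
        have := (ih [] n (List.isChain_singleton _) le_rfl (by simpa using isAltList_singleton _)).1
        simp at this
        omega
      · simp only [List.map_append, List.map_cons, List.map_nil, List.concat_eq_append,
          isAltList_concat_concat, List.length_map, List.length_append, List.length_cons,
          List.length_nil] at halt hc ⊢
        have hb := isChain_of_concat_lt hc
        have hbn : b ≤ n := by
          have := hb.2 b (by simp)
          omega
        obtain ⟨h1, h2⟩ := ih l' b hb.1 hbn (by simpa using halt.1)
        have h3 := halt.2
        refine ⟨?_, fun _ => by simp⟩
        simp only [altCount]
        unfold turn
        rcases h1.lt_or_eq with h1 | h1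
        · omega
        · have h2 := h2 h1
          split_ifs at h2 h3 ⊢ <;> first | omega | order
    · obtain ⟨h1, h2⟩ := ih l i hc hni halt
      have hs : altCount a (n + 1) = altCount a n + turn (altCount a n) (a n) (a (n + 1)) := rfl
      refine ⟨by omega, fun h => ?_⟩
      have h2 := h2 (by omega)
      have ht : turn (altCount a n) (a n) (a (n + 1)) = 0 := by omega
      rw [hs, ht, add_zero]
      unfold turn at ht
      split_ifs at ht h2 ⊢ <;> first | omega | order

/-- The greedy alternating subsequence is a longest one. -/
lemma LAon_range_succ {α : Type*} [LinearOrder α] (a : ℕ → α) (n : ℕ) :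
    LAon a (Finset.range (n + 1)) = altCount a n := by
  refine IsGreatest.csSup_eq ⟨?_, ?_⟩
  · obtain ⟨l, hlen, hc, hlt, halt⟩ := exists_isAltList_altCount a n
    refine ⟨l ++ [n], by simpa using hlen, isChain_concat_lt_of_forall_lt hc hlt, ?_, halt⟩
    intro i hi
    rcases List.mem_append.1 hi with hi | hi
    · exact Finset.mem_range.2 ((hlt i hi).trans n.lt_succ_self)
    · simp_all
  · rintro m ⟨l, rfl, hc, hmem, halt⟩
    rcases List.eq_nil_or_concat l with rfl | ⟨l', b, rfl⟩
    · simp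
    · simp only [List.concat_eq_append] at hc hmem halt ⊢
      have := (length_le_altCount a n l' b hc
        (Nat.lt_succ_iff.1 (Finset.mem_range.1 (hmem b (by simp)))) halt).1
      simpa using this

lemma turn_le_one {α : Type*} [LinearOrder α] (m : ℕ) (s r : α) : turn m s r ≤ 1 := by
  unfold turn
  split_ifs <;> simp

lemma altCount_mono {α : Type*} [LinearOrder α] (a : ℕ → α) : Monotone (altCount a) :=
  monotone_nat_of_le_succ fun _ => Nat.le_add_right _ _

lemma altCount_le {α : Type*} [LinearOrder α] (a : ℕ → α) (n : ℕ) : altCount a n ≤ n + 1 := by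
  induction n with
  | zero => rfl
  | succ n ih =>
    have := turn_le_one (altCount a n) (a n) (a (n + 1))
    simp only [altCount]
    omega

lemma altCount_congr {α : Type*} [LinearOrder α] {a b : ℕ → α} {n : ℕ}
    (h : ∀ j ≤ n, a j = b j) : altCount a n = altCount b n := by
  induction n with
  | zero => rfl
  | succ n ih =>
    simp only [altCount, ih fun j hj => h j (hj.trans n.le_succ), h n n.le_succ, h (n + 1) le_rfl]

lemma turn_congr_of_mod_two_eq {α : Type*} [LinearOrder α] {m m' : ℕ} (h : m % 2 = m' % 2)
    (s r : α) : turn m s r = turn m' s r := by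
  unfold turn
  rw [h]

/-! ### The Poisson equation -/

lemma sum_pow_row {ι : Type*} [Fintype ι] [DecidableEq ι] (M : Matrix ι ι ℝ) (u : ι → ℝ)
    (hu : ∀ s, ∑ r, M s r * u r = u s) (k : ℕ) (s : ι) : ∑ r, (M ^ k) s r * u r = u s := by
  have h : M.mulVec u = u := funext hu
  have hk : (M ^ k).mulVec u = u := by
    induction k with
    | zero => simp
    | succ k ih => rw [pow_succ, ← Matrix.mulVec_mulVec, h, ih]
  exact congrFun hk s

/-- Harmonic functions of an irreducible stochastic matrix are constant. -/
lemma eq_of_harmonic {ι : Type*} [Fintype ι] [DecidableEq ι] (M : Matrix ι ι ℝ)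
    (hrow : ∀ r, ∑ s, M r s = 1) (hprim : ∃ k : ℕ, ∀ r s, 0 < (M ^ k) r s)
    (u : ι → ℝ) (hu : ∀ s, ∑ r, M s r * u r = u s) (i j : ι) : u i = u j := by
  obtain ⟨k, hk⟩ := hprim
  obtain ⟨r, -, hr⟩ := Finset.exists_max_image Finset.univ u ⟨i, Finset.mem_univ i⟩
  have h1 : ∑ s, (M ^ k) r s = 1 := by
    simpa using sum_pow_row M (fun _ => 1) (by simpa using hrow) k r
  have h0 : ∑ s, (M ^ k) r s * (u r - u s) = 0 := by
    simp only [mul_sub, Finset.sum_sub_distrib, sum_pow_row M u hu k r, ← Finset.sum_mul, h1]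
    ring
  have hall : ∀ s, u s = u r := fun s => by
    have := (Finset.sum_eq_zero_iff_of_nonneg fun s hs =>
      mul_nonneg (hk r s).le (sub_nonneg.2 (hr s hs))).1 h0 s (Finset.mem_univ s)
    rcases mul_eq_zero.1 this with h | h
    · exact absurd h (hk r s).ne'
    · linarith
  rw [hall i, hall j]

/-- Solvability of the Poisson equation for an irreducible stochastic matrix. -/
lemma exists_poisson {ι : Type*} [Fintype ι] [DecidableEq ι] (M : Matrix ι ι ℝ)
    (hrow : ∀ r, ∑ s, M r s = 1) (hprim : ∃ k : ℕ, ∀ r s, 0 < (M ^ k) r s)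
    (π : ι → ℝ) (hπ1 : ∑ r, π r = 1) (hπstat : ∀ s, ∑ r, π r * M r s = π s) (G : ι → ℝ) :
    ∃ u : ι → ℝ, ∀ s, u s - ∑ r, M s r * u r = G s - ∑ r, π r * G r := by
  let L : (ι → ℝ) →ₗ[ℝ] (ι → ℝ) :=
    { toFun := fun u s => u s - ∑ r, M s r * u r + ∑ r, π r * u r
      map_add' := fun u v => by
        funext s
        simp only [Pi.add_apply, mul_add, Finset.sum_add_distrib]
        ring
      map_smul' := fun c u => by
        funext s
        simp only [Pi.smul_apply, smul_eq_mul, RingHom.id_apply, mul_left_comm _ c,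
          ← Finset.mul_sum]
        ring }
  have hL : ∀ u s, L u s = u s - ∑ r, M s r * u r + ∑ r, π r * u r := fun _ _ => rfl
  have hπL : ∀ u, ∑ s, π s * L u s = ∑ r, π r * u r := fun u => by
    have : ∑ s, π s * ∑ r, M s r * u r = ∑ r, π r * u r := by
      simp only [Finset.mul_sum]
      rw [Finset.sum_comm]
      refine Finset.sum_congr rfl fun r _ => ?_
      rw [← hπstat r, Finset.sum_mul]
      exact Finset.sum_congr rfl fun s _ => by ring
    simp only [hL, mul_add, mul_sub, Finset.sum_add_distrib, Finset.sum_sub_distrib, this,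
      ← Finset.sum_mul, hπ1]
    ring
  have hinj : Function.Injective L := by
    rw [← LinearMap.ker_eq_bot, LinearMap.ker_eq_bot']
    intro u hu
    have hπu : ∑ r, π r * u r = 0 := by
      rw [← hπL, hu]
      simp
    have hharm : ∀ s, ∑ r, M s r * u r = u s := fun s => by
      have := congrFun hu s
      rw [hL, hπu] at this
      simp only [Pi.zero_apply] at this
      linarith
    funext i
    have hconst := eq_of_harmonic M hrow hprim u hharm
    have : ∑ r, π r * u r = u i := by
      rw [Finset.sum_congr rfl fun r _ => by rw [hconst r i], ← Finset.sum_mul, hπ1, one_mul]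
    rw [← this, hπu]
    rfl
  obtain ⟨u, hu⟩ := LinearMap.injective_iff_surjective.1 hinj G
  refine ⟨u, fun s => ?_⟩
  have h1 := congrFun hu s
  have h2 := hπL u
  rw [hu] at h2
  rw [hL] at h1
  linarith

/-- The probability that a chain in state `s` with greedy alternating subsequence of length `m`
turns when it next leaves `s`. -/
def exitTurnProb {q : ℕ} (p : Fin q → Fin q → ℝ) (m : ℕ) (s : Fin q) : ℝ :=
  (∑ r, p s r * (turn m s r : ℝ)) / (1 - p s s)

/-- The probability that the visit of a chain to `r` entered from `s` ends with a turn; it is set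
to zero if `s = r`. -/
def entryTurnProb {q : ℕ} (p : Fin q → Fin q → ℝ) (s r : Fin q) : ℝ :=
  if s = r then 0 else if s < r then exitTurnProb p 1 r else exitTurnProb p 0 r

lemma exitTurnProb_congr {q : ℕ} (p : Fin q → Fin q → ℝ) {m m' : ℕ} (h : m % 2 = m' % 2)
    (s : Fin q) : exitTurnProb p m s = exitTurnProb p m' s := by
  unfold exitTurnProb
  simp only [turn_congr_of_mod_two_eq h]

lemma exitTurnProb_add_turn {q : ℕ} (p : Fin q → Fin q → ℝ) (m : ℕ) (s r : Fin q) :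
    exitTurnProb p (m + turn m s r) r
      = (if s = r then exitTurnProb p m s else 0) + entryTurnProb p s r := by
  unfold entryTurnProb
  by_cases hsr : s = r
  · subst hsr
    simp [turn]
  · simp only [hsr, if_false, zero_add]
    split_ifs with hlt
    · refine exitTurnProb_congr p ?_ r
      unfold turn
      split_ifs <;> omega
    · refine exitTurnProb_congr p ?_ r
      unfold turn
      split_ifs <;> omega

lemma sum_entryTurnProb_eq_oscMC {q : ℕ} (p : Fin q → Fin q → ℝ) (π : Fin q → ℝ) :
    ∑ t, π t * ∑ s, p t s * entryTurnProb p t s = OscMC p π := by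
  unfold OscMC
  rw [← Finset.sum_add_distrib]
  refine Finset.sum_congr rfl fun t _ => ?_
  rw [← Finset.sum_add_distrib, Finset.mul_sum]
  refine Finset.sum_congr rfl fun s _ => ?_
  rw [← Finset.sum_add_distrib]
  unfold entryTurnProb exitTurnProb
  rcases lt_trichotomy t s with h | h | h
  · rw [if_neg h.ne, if_pos h, Finset.sum_div, Finset.mul_sum, Finset.mul_sum]
    refine Finset.sum_congr rfl fun r _ => ?_
    by_cases hr : r < s <;> simp [turn, hr, h, h.not_gt]
    ring
  · simp [h]
  · rw [if_neg h.ne', if_neg h.not_gt, Finset.sum_div, Finset.mul_sum, Finset.mul_sum]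
    refine Finset.sum_congr rfl fun r _ => ?_
    by_cases hr : s < r <;> simp [turn, hr, h, h.not_gt]
    ring

/-- A bounded corrector turning `altCount` minus its drift into a martingale. -/
lemma exists_corrector {q : ℕ} (p : Fin q → Fin q → ℝ) (hprow : ∀ r, ∑ s, p r s = 1)
    (hpdiag : ∀ r, p r r < 1) (herg : ∃ k : ℕ, ∀ r s, 0 < ((Matrix.of p) ^ k) r s)
    (π : Fin q → ℝ) (hπ1 : ∑ r, π r = 1) (hπstat : ∀ s, ∑ r, π r * p r s = π s) :
    ∃ (V : ℕ → Fin q → ℝ) (B : ℝ), (∀ m s, |V m s| ≤ B) ∧ ∀ m s,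
      ∑ r, p s r * ((turn m s r : ℝ) + V (m + turn m s r) r - V m s - OscMC p π) = 0 := by
  obtain ⟨u, hu⟩ := exists_poisson (Matrix.of p) hprow herg π hπ1 hπstat
    fun s => ∑ r, p s r * entryTurnProb p s r
  simp only [Matrix.of_apply, sum_entryTurnProb_eq_oscMC] at hu
  refine ⟨fun m s => exitTurnProb p m s + u s,
    ∑ s, (|exitTurnProb p 0 s + u s| + |exitTurnProb p 1 s + u s|), fun m s => ?_, fun m s => ?_⟩
  · refine le_trans ?_ (Finset.single_le_sum
      (f := fun s => |exitTurnProb p 0 s + u s| + |exitTurnProb p 1 s + u s|)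
      (fun _ _ => by positivity) (Finset.mem_univ s))
    rcases Nat.mod_two_eq_zero_or_one m with h | h
    · change |exitTurnProb p m s + u s| ≤ _
      rw [exitTurnProb_congr p (show m % 2 = 0 % 2 from h)]
      linarith [abs_nonneg (exitTurnProb p 1 s + u s)]
    · change |exitTurnProb p m s + u s| ≤ _
      rw [exitTurnProb_congr p (show m % 2 = 1 % 2 from h)]
      linarith [abs_nonneg (exitTurnProb p 0 s + u s)]
  · have hexit : ∑ r, p s r * (turn m s r : ℝ) = exitTurnProb p m s * (1 - p s s) := by
      unfold exitTurnProb
      rw [div_mul_cancel₀]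
      linarith [hpdiag s]
    simp only [exitTurnProb_add_turn, mul_sub, mul_add, Finset.sum_add_distrib,
      Finset.sum_sub_distrib, ← Finset.sum_mul, hprow, hexit, mul_ite, mul_zero,
      Finset.sum_ite_eq, Finset.mem_univ, if_true]
    linarith [hu s]

/-! ### Functions of finitely many coordinates of a process -/

lemma measurable_of_dependsOn {Ω : Type*} [MeasurableSpace Ω] {q : ℕ} {x : ℕ → Ω → Fin q}
    (hx : ∀ k, Measurable (x k)) {n : ℕ} {f : (ℕ → Fin q) → ℝ} (hf : DependsOn f (Set.Iic n)) :
    Measurable fun ω => f fun i => x i ω := by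
  obtain ⟨g, rfl⟩ := dependsOn_iff_exists_comp.1 hf
  exact (measurable_of_finite g).comp (measurable_pi_iff.2 fun i => hx i)

lemma exists_bound_of_dependsOn {q : ℕ} {n : ℕ} {f : (ℕ → Fin q) → ℝ}
    (hf : DependsOn f (Set.Iic n)) : ∃ C, ∀ a, |f a| ≤ C := by
  obtain ⟨g, rfl⟩ := dependsOn_iff_exists_comp.1 hf
  exact ⟨∑ h, |g h|, fun a => Finset.single_le_sum (f := fun h => |g h|)
    (fun _ _ => abs_nonneg _) (Finset.mem_univ _)⟩

lemma integrable_of_dependsOn {Ω : Type*} [MeasurableSpace Ω] (P : Measure Ω)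
    [IsFiniteMeasure P] {q : ℕ} {x : ℕ → Ω → Fin q} (hx : ∀ k, Measurable (x k)) {n : ℕ}
    {f : (ℕ → Fin q) → ℝ} (hf : DependsOn f (Set.Iic n)) :
    Integrable (fun ω => f fun i => x i ω) P := by
  obtain ⟨C, hC⟩ := exists_bound_of_dependsOn hf
  exact Integrable.of_bound (measurable_of_dependsOn hx hf).aestronglyMeasurable C
    (ae_of_all _ fun ω => hC _)

/-- Martingale property of a Markov chain: a function of the past and the next state whose
one-step conditional mean vanishes has zero expectation. -/
lemma integral_eq_zero_of_condMean_eq_zero {Ω : Type*} [MeasurableSpace Ω] (P : Measure Ω)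
    [IsFiniteMeasure P] {q : ℕ} {p : Fin q → Fin q → ℝ} {x : ℕ → Ω → Fin q}
    (hxmeas : ∀ k, Measurable (x k))
    (hmarkov : ∀ (k : ℕ) (h : ℕ → Fin q) (s : Fin q),
      (P {ω | x (k + 1) ω = s ∧ ∀ j ≤ k, x j ω = h j}).toReal
        = p (h k) s * (P {ω | ∀ j ≤ k, x j ω = h j}).toReal)
    (k : ℕ) (Z : (ℕ → Fin q) → Fin q → ℝ)
    (hZ : ∀ r, DependsOn (fun a => Z a r) (Set.Iic k))
    (hmean : ∀ a, ∑ r, p (a k) r * Z a r = 0) :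
    ∫ ω, Z (fun i => x i ω) (x (k + 1) ω) ∂P = 0 := by
  let e : (Set.Iic k → Fin q) → ℕ → Fin q := fun h j => h ⟨min j k, min_le_right j k⟩
  have he : ∀ h (j : ℕ) (hj : j ≤ k), e h j = h ⟨j, hj⟩ := fun h j hj => by
    simp only [e, min_eq_left hj]
  let A : (Set.Iic k → Fin q) → Fin q → Set Ω :=
    fun h r => {ω | x (k + 1) ω = r ∧ ∀ j ≤ k, x j ω = e h j}
  have hA : ∀ h r, MeasurableSet (A h r) := fun h r => by
    have : A h r = x (k + 1) ⁻¹' {r} ∩ ⋂ j ∈ Set.Iic k, x j ⁻¹' {e h j} := by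
      ext ω
      simp [A]
    rw [this]
    exact (hxmeas _ (measurableSet_singleton _)).inter
      (MeasurableSet.biInter (Set.to_countable _) fun j _ => hxmeas j (measurableSet_singleton _))
  have hpt : ∀ ω, Z (fun i => x i ω) (x (k + 1) ω)
      = ∑ h, ∑ r, (A h r).indicator (fun _ => Z (e h) r) ω := fun ω => by
    rw [Finset.sum_eq_single (fun i : Set.Iic k => x i ω),
      Finset.sum_eq_single (x (k + 1) ω)]
    · rw [Set.indicator_of_mem]
      · exact hZ _ fun j hj => (he (fun i => x i ω) j hj).symm
      · exact ⟨rfl, fun j hj => (he (fun i => x i ω) j hj).symm⟩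
    · intro r _ hr
      exact Set.indicator_of_notMem (fun hω => hr hω.1.symm) _
    · simp
    · intro h _ hh
      refine Finset.sum_eq_zero fun r _ => Set.indicator_of_notMem (fun hω => hh ?_) _
      funext i
      rw [hω.2 i i.2, he h i i.2]
    · simp
  have hint : ∀ h r, Integrable ((A h r).indicator fun _ => Z (e h) r) P := fun h r =>
    (integrable_const _).indicator (hA h r)
  simp_rw [hpt]
  rw [integral_finsetSum _ fun h _ => integrable_finsetSum _ fun r _ => hint h r]
  refine Finset.sum_eq_zero fun h _ => ?_
  rw [integral_finsetSum _ fun r _ => hint h r]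
  have hterm : ∀ r, ∫ ω, (A h r).indicator (fun _ => Z (e h) r) ω ∂P
      = (P {ω | ∀ j ≤ k, x j ω = e h j}).toReal * (p (e h k) r * Z (e h) r) := fun r => by
    rw [integral_indicator_const _ (hA h r), smul_eq_mul, measureReal_def, hmarkov k (e h) r]
    ring
  simp_rw [hterm]
  rw [← Finset.mul_sum, hmean, mul_zero]

/-- A strong law along squares for processes whose second moments grow at most linearly. -/
lemma ae_tendsto_div_sq_of_integral_sq_le {Ω : Type*} [MeasurableSpace Ω] (P : Measure Ω)
    {M : ℕ → Ω → ℝ} (hmeas : ∀ n, Measurable (M n)) (hint : ∀ n, Integrable (fun ω => M n ω ^ 2) P)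
    {C : ℝ} (hM : ∀ n : ℕ, ∫ ω, M n ω ^ 2 ∂P ≤ C * (n + 1)) :
    ∀ᵐ ω ∂P, Tendsto (fun k : ℕ => M ((k + 1) ^ 2) ω / ((k + 1) ^ 2 : ℕ)) atTop (nhds 0) := by
  have hC : 0 ≤ C := by
    have := (integral_nonneg fun ω => sq_nonneg (M 0 ω)).trans (hM 0)
    simpa using this
  let f : ℕ → Ω → ENNReal := fun k ω => ENNReal.ofReal ((M ((k + 1) ^ 2) ω / ((k + 1) ^ 2 : ℕ)) ^ 2)
  have hf : ∀ k, Measurable (f k) := fun k =>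
    (((hmeas _).div_const _).pow_const 2).ennreal_ofReal
  have hlint : ∀ k : ℕ, ∫⁻ ω, f k ω ∂P ≤ ENNReal.ofReal (2 * C * (1 / ((k + 1 : ℕ) : ℝ) ^ 2)) := by
    intro k
    have hi : Integrable (fun ω => (M ((k + 1) ^ 2) ω / ((k + 1) ^ 2 : ℕ)) ^ 2) P := by
      simp_rw [div_pow]
      exact (hint _).div_const _
    simp only [f]
    rw [← ofReal_integral_eq_lintegral_ofReal hi (ae_of_all _ fun ω => sq_nonneg _)]
    refine ENNReal.ofReal_le_ofReal ?_
    simp_rw [div_pow]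
    rw [integral_div]
    have hk : (1 : ℝ) ≤ ((k + 1 : ℕ) : ℝ) ^ 2 := by
      refine one_le_pow₀ ?_
      push_cast
      linarith [(Nat.cast_nonneg k : (0 : ℝ) ≤ k)]
    have h1 := hM ((k + 1) ^ 2)
    rw [Nat.cast_pow] at h1 ⊢
    generalize ((k + 1 : ℕ) : ℝ) ^ 2 = y at *
    have hy : 0 < y := by linarith
    rw [div_le_iff₀ (by positivity)]
    calc _ ≤ C * (y + 1) := h1
      _ ≤ C * (2 * y) := by gcongr; linarith
      _ = _ := by field_simp
  have hsum : ∑' k : ℕ, ∫⁻ ω, f k ω ∂P ≠ ⊤ := by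
    refine ne_top_of_le_ne_top ?_ (ENNReal.tsum_le_tsum hlint)
    refine Summable.tsum_ofReal_ne_top (Summable.mul_left _ ?_)
    exact (summable_nat_add_iff 1).2 (Real.summable_one_div_nat_pow.2 one_lt_two)
  rw [← lintegral_tsum fun k => (hf k).aemeasurable] at hsum
  filter_upwards [ae_lt_top (Measurable.tsum hf) hsum] with ω hω
  have h1 := ENNReal.tendsto_atTop_zero_of_tsum_ne_top hω.ne
  have h2 := (ENNReal.tendsto_toReal ENNReal.zero_ne_top).comp h1
  have h3 : Tendsto (fun k : ℕ => (M ((k + 1) ^ 2) ω / ((k + 1) ^ 2 : ℕ)) ^ 2) atTop (nhds 0) := by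
    refine h2.congr fun k => ?_
    simp only [f, Function.comp]
    rw [ENNReal.toReal_ofReal (sq_nonneg _)]
  have h4 := h3.sqrt
  simp_rw [Real.sqrt_sq_eq_abs, Real.sqrt_zero] at h4
  exact (tendsto_zero_iff_abs_tendsto_zero _).2 h4

/-- `altCount` corrected by `V` and compensated by the drift `c`. -/
def compensatedCount {q : ℕ} (V : ℕ → Fin q → ℝ) (c : ℝ) (n : ℕ) (a : ℕ → Fin q) : ℝ :=
  altCount a n + V (altCount a n) (a n) - n * c

lemma dependsOn_compensatedCount {q : ℕ} (V : ℕ → Fin q → ℝ) (c : ℝ) (n : ℕ) :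
    DependsOn (compensatedCount V c n) (Set.Iic n) := fun a b h => by
  unfold compensatedCount
  rw [altCount_congr fun j hj => h j hj, h n (Set.mem_Iic.2 le_rfl)]

/-- The second moment of a compensated count grows at most linearly. -/
lemma exists_integral_sq_compensatedCount_le {Ω : Type*} [MeasurableSpace Ω] (P : Measure Ω)
    [IsProbabilityMeasure P] {q : ℕ} {p : Fin q → Fin q → ℝ} {x : ℕ → Ω → Fin q}
    (hxmeas : ∀ k, Measurable (x k))
    (hmarkov : ∀ (k : ℕ) (h : ℕ → Fin q) (s : Fin q),
      (P {ω | x (k + 1) ω = s ∧ ∀ j ≤ k, x j ω = h j}).toReal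
        = p (h k) s * (P {ω | ∀ j ≤ k, x j ω = h j}).toReal)
    {V : ℕ → Fin q → ℝ} {B c : ℝ} (hB : ∀ m s, |V m s| ≤ B)
    (hV : ∀ m s, ∑ r, p s r * ((turn m s r : ℝ) + V (m + turn m s r) r - V m s - c) = 0) :
    ∃ C : ℝ, ∀ n : ℕ, ∫ ω, compensatedCount V c n (fun i => x i ω) ^ 2 ∂P ≤ C * (n + 1) := by
  let Y : ℕ → (ℕ → Fin q) → Fin q → ℝ := fun n a r =>
    (turn (altCount a n) (a n) r : ℝ) + V (altCount a n + turn (altCount a n) (a n) r) r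
      - V (altCount a n) (a n) - c
  have hYdep : ∀ n r, DependsOn (fun a => Y n a r) (Set.Iic n) := fun n r a b h => by
    simp only [Y]
    rw [altCount_congr fun j hj => h j hj, h n (Set.mem_Iic.2 le_rfl)]
  have hsucc : ∀ n a, compensatedCount V c (n + 1) a
      = compensatedCount V c n a + Y n a (a (n + 1)) := fun n a => by
    simp only [compensatedCount, altCount, Y]
    push_cast
    ring
  have hYdep' : ∀ n, DependsOn (fun a => Y n a (a (n + 1))) (Set.Iic (n + 1)) := fun n a b h => by
    simp only
    rw [h (n + 1) (Set.mem_Iic.2 le_rfl)]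
    exact hYdep n _ fun j hj => h j (Set.Iic_subset_Iic.2 n.le_succ hj)
  have hYbound : ∀ n a r, |Y n a r| ≤ 1 + 2 * B + |c| := fun n a r => by
    have h1 : ((turn (altCount a n) (a n) r : ℕ) : ℝ) ≤ 1 := by exact_mod_cast turn_le_one _ _ _
    have h0 : (0 : ℝ) ≤ ((turn (altCount a n) (a n) r : ℕ) : ℝ) := Nat.cast_nonneg _
    have h2 := abs_le.1 (hB (altCount a n + turn (altCount a n) (a n) r) r)
    have h3 := abs_le.1 (hB (altCount a n) (a n))
    have h4 := abs_le.1 (le_refl |c|)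
    simp only [Y]
    rw [abs_le]
    constructor <;> linarith
  have hYsq : ∀ n a r, Y n a r ^ 2 ≤ (1 + 2 * B + |c|) ^ 2 := fun n a r =>
    sq_le_sq' (abs_le.1 (hYbound n a r)).1 (abs_le.1 (hYbound n a r)).2
  refine ⟨(1 + 2 * B + |c|) ^ 2, fun n => ?_⟩
  have hMsq : ∀ n, Integrable (fun ω => compensatedCount V c n (fun i => x i ω) ^ 2) P := fun n =>
    integrable_of_dependsOn P hxmeas (n := n) (f := fun a => compensatedCount V c n a ^ 2) fun a b h => by
      simp only [dependsOn_compensatedCount V c n h]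
  have hconst : ∀ f : Ω → ℝ, Integrable f P → (∀ ω, f ω ≤ (1 + 2 * B + |c|) ^ 2) →
      ∫ ω, f ω ∂P ≤ (1 + 2 * B + |c|) ^ 2 := fun f hf h => by
    simpa using integral_mono hf (integrable_const ((1 + 2 * B + |c|) ^ 2)) h
  induction n with
  | zero =>
    refine (hconst _ (hMsq 0) fun ω => ?_).trans_eq (by simp)
    have h3 := abs_le.1 (hB 1 (x 0 ω))
    have h4 := abs_nonneg c
    simp only [compensatedCount, altCount, Nat.cast_one, Nat.cast_zero, zero_mul, sub_zero]
    refine sq_le_sq' ?_ ?_ <;> linarith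
  | succ n ih =>
    have hcross : ∫ ω, compensatedCount V c n (fun i => x i ω) *
        Y n (fun i => x i ω) (x (n + 1) ω) ∂P = 0 := by
      refine integral_eq_zero_of_condMean_eq_zero P hxmeas hmarkov n
        (fun a r => compensatedCount V c n a * Y n a r) (fun r a b h => ?_) fun a => ?_
      · simp only [dependsOn_compensatedCount V c n h]
        rw [show Y n a r = Y n b r from hYdep n r h]
      · simp_rw [mul_left_comm _ (compensatedCount V c n a)]
        rw [← Finset.mul_sum, hV, mul_zero]
    have hcrossint : Integrable (fun ω => compensatedCount V c n (fun i => x i ω) *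
        Y n (fun i => x i ω) (x (n + 1) ω)) P :=
      integrable_of_dependsOn P hxmeas
        (n := n + 1) (f := fun a => compensatedCount V c n a * Y n a (a (n + 1))) fun a b h => by
          have h1 := hYdep' n h
          have h2 := dependsOn_compensatedCount V c n
            fun j hj => h j (Set.Iic_subset_Iic.2 n.le_succ hj)
          simp only at h1 ⊢
          rw [h1, h2]
    have hYint : Integrable (fun ω => Y n (fun i => x i ω) (x (n + 1) ω) ^ 2) P :=
      integrable_of_dependsOn P hxmeas (n := n + 1) (f := fun a => Y n a (a (n + 1)) ^ 2) fun a b h => by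
        have h1 := hYdep' n h
        simp only at h1 ⊢
        rw [h1]
    have hYle := hconst _ hYint fun ω => hYsq n _ _
    have hexp : ∀ ω, compensatedCount V c (n + 1) (fun i => x i ω) ^ 2
        = compensatedCount V c n (fun i => x i ω) ^ 2
          + 2 * (compensatedCount V c n (fun i => x i ω) * Y n (fun i => x i ω) (x (n + 1) ω))
          + Y n (fun i => x i ω) (x (n + 1) ω) ^ 2 := fun ω => by
      rw [hsucc]
      ring
    have haddint : Integrable (fun ω => compensatedCount V c n (fun i => x i ω) ^ 2
        + 2 * (compensatedCount V c n (fun i => x i ω) * Y n (fun i => x i ω) (x (n + 1) ω))) P :=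
      (hMsq n).add (hcrossint.const_mul 2)
    simp_rw [hexp]
    rw [integral_add haddint hYint,
      integral_add (hMsq n) (hcrossint.const_mul 2), integral_const_mul, hcross]
    push_cast
    linarith

lemma tendsto_add_one_sq_atTop : Tendsto (fun k : ℕ => (k + 1) ^ 2) atTop atTop :=
  (tendsto_pow_atTop two_ne_zero).comp (tendsto_add_atTop_nat 1)

/-- A monotone sequence with linear growth rate `l` along the squares has growth rate `l`. -/
lemma tendsto_div_of_monotone_of_tendsto_div_sq {u : ℕ → ℝ} {l : ℝ} (hu : Monotone u)
    (h : Tendsto (fun k : ℕ => u ((k + 1) ^ 2) / ((k + 1) ^ 2 : ℕ)) atTop (nhds l)) :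
    Tendsto (fun n : ℕ => u n / n) atTop (nhds l) := by
  refine tendsto_div_of_monotone_of_exists_subseq_tendsto_div u l hu fun a ha =>
    ⟨fun k => (k + 1) ^ 2, ?_, tendsto_add_one_sq_atTop, h⟩
  have hlim : Tendsto (fun k : ℕ => (1 + 1 / ((k : ℝ) + 1)) ^ 2) atTop (nhds ((1 + 0) ^ 2)) :=
    (tendsto_one_div_add_atTop_nhds_zero_nat.const_add 1).pow 2
  filter_upwards [hlim.eventually_lt_const (u := a) (by simpa using ha)] with k hk
  have hk0 : (0 : ℝ) < (k : ℝ) + 1 := by positivity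
  have : (((k + 1 + 1) ^ 2 : ℕ) : ℝ) = (1 + 1 / ((k : ℝ) + 1)) ^ 2 * (((k + 1) ^ 2 : ℕ) : ℝ) := by
    push_cast
    field_simp
  rw [this]
  gcongr

lemma measurable_altCount {Ω : Type*} [MeasurableSpace Ω] {q : ℕ} {x : ℕ → Ω → Fin q}
    (hx : ∀ k, Measurable (x k)) (n : ℕ) :
    Measurable fun ω => (altCount (fun i => x i ω) n : ℝ) :=
  measurable_of_dependsOn hx (f := fun a => (altCount a n : ℝ)) (n := n) fun a b h => by
    simp only [altCount_congr fun j hj => h j hj]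

lemma altCount_div_le_two {α : Type*} [LinearOrder α] (a : ℕ → α) (n : ℕ) :
    (altCount a n : ℝ) / n ≤ 2 := by
  rcases Nat.eq_zero_or_pos n with rfl | hn
  · simp
  · rw [div_le_iff₀ (by exact_mod_cast hn)]
    have := altCount_le a n
    exact_mod_cast (by omega : altCount a n ≤ 2 * n)

/-- for an ergodic Markov chain `(x_k)` on `[q]` with transition
probabilities `p` (with `p_{r,r} < 1`), stationary distribution `π`, started at
stationarity, `LAₙ(x₀,…,xₙ)/n` converges, almost surely and in `L¹`, to
`Osc(x)`. -/
theorem stmt19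
    {Ω : Type*} [MeasurableSpace Ω] (P : Measure Ω) [IsProbabilityMeasure P]
    (q : ℕ) (p : Fin q → Fin q → ℝ)
    (hp0 : ∀ r s, 0 ≤ p r s) (hprow : ∀ r, ∑ s, p r s = 1)
    (hpdiag : ∀ r, p r r < 1)
    -- ergodicity (irreducible and aperiodic, i.e. primitive)
    (herg : ∃ k : ℕ, ∀ r s, 0 < ((Matrix.of p) ^ k) r s)
    (π : Fin q → ℝ) (hπ0 : ∀ r, 0 ≤ π r) (hπ1 : ∑ r, π r = 1)
    (hπstat : ∀ s, ∑ r, π r * p r s = π s)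
    (x : ℕ → Ω → Fin q) (hxmeas : ∀ k, Measurable (x k))
    -- started at stationarity
    (hstart : ∀ r, (P {ω | x 0 ω = r}).toReal = π r)
    -- Markov property of `(x_k)` with transition probabilities `p`
    (hmarkov : ∀ (k : ℕ) (h : ℕ → Fin q) (s : Fin q),
      (P {ω | x (k + 1) ω = s ∧ ∀ j ≤ k, x j ω = h j}).toReal
        = p (h k) s * (P {ω | ∀ j ≤ k, x j ω = h j}).toReal) :
    -- almost sure convergence ...
    (∀ᵐ ω ∂P,
      Tendsto (fun n : ℕ => (LAon (fun i => x i ω) (Finset.range (n + 1)) : ℝ) / n)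
        atTop (nhds (OscMC p π)))
    -- ... and convergence in the mean
    ∧ Tendsto (fun n : ℕ =>
        ∫ ω, |(LAon (fun i => x i ω) (Finset.range (n + 1)) : ℝ) / n - OscMC p π| ∂P)
        atTop (nhds 0) := by
  simp only [LAon_range_succ]
  obtain ⟨V, B, hB, hV⟩ := exists_corrector p hprow hpdiag herg π hπ1 hπstat
  obtain ⟨C, hC⟩ := exists_integral_sq_compensatedCount_le P hxmeas hmarkov hB hV
  have hdep := dependsOn_compensatedCount V (OscMC p π)
  have hsq := ae_tendsto_div_sq_of_integral_sq_le P
    (M := fun n ω => compensatedCount V (OscMC p π) n fun i => x i ω)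
    (fun n => measurable_of_dependsOn hxmeas (hdep n))
    (fun n => integrable_of_dependsOn P hxmeas
      (n := n) (f := fun a => compensatedCount V (OscMC p π) n a ^ 2) fun a b h => by
        simp only [hdep n h]) hC
  have hae : ∀ᵐ ω ∂P, Tendsto (fun n : ℕ => (altCount (fun i => x i ω) n : ℝ) / n)
      atTop (nhds (OscMC p π)) := by
    filter_upwards [hsq] with ω hω
    refine tendsto_div_of_monotone_of_tendsto_div_sq
      (u := fun n => (altCount (fun i => x i ω) n : ℝ))
      (fun m n hmn => Nat.cast_le.2 (altCount_mono _ hmn)) ?_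
    have hVlim : Tendsto (fun k : ℕ => V (altCount (fun i => x i ω) ((k + 1) ^ 2))
        (x ((k + 1) ^ 2) ω) / ((k + 1) ^ 2 : ℕ)) atTop (nhds 0) := by
      refine squeeze_zero_norm (fun k => ?_)
        ((tendsto_const_div_atTop_nhds_zero_nat B).comp tendsto_add_one_sq_atTop)
      rw [norm_div, Real.norm_eq_abs, Real.norm_natCast]
      exact div_le_div_of_nonneg_right (hB _ _) (Nat.cast_nonneg _)
    have hlim := (hω.sub hVlim).add_const (OscMC p π)
    rw [sub_zero, zero_add] at hlim
    refine hlim.congr fun k => ?_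
    have hk : (((k + 1) ^ 2 : ℕ) : ℝ) ≠ 0 := by positivity
    simp only [compensatedCount]
    field_simp
    ring
  refine ⟨hae, ?_⟩
  have hdom := tendsto_integral_of_dominated_convergence (μ := P) (f := fun _ => (0 : ℝ))
    (F := fun (n : ℕ) ω => |(altCount (fun i => x i ω) n : ℝ) / n - OscMC p π|)
    (fun _ => 2 + |OscMC p π|)
    (fun n => ((((measurable_altCount hxmeas n).div_const _).sub_const _).norm).aestronglyMeasurable)
    (integrable_const _) (fun n => ae_of_all _ fun ω => ?_) ?_
  · simpa using hdom
  · rw [Real.norm_eq_abs, abs_abs]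
    refine (abs_sub _ _).trans (add_le_add_left ?_ _)
    rw [abs_of_nonneg (by positivity)]
    exact altCount_div_le_two _ n
  · filter_upwards [hae] with ω hω
    simpa using (hω.sub_const (OscMC p π)).abs

end
end
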